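/- Parallel Wall Theorem (consequence of Brink–Howlett): Let $(W,S)$ be a Coxeter system with $S$ finite. There exists a constant $C'' \geq 0$ such that in the Coxeter complex, any chamber at gallery distance at least $C''$ from a given wall $H$ is separated from $H$ by a wall parallel to (disjoint from) $H$. -/

import Mathlib

/-- The wall of a reflection `t`, encoded as the set of ordered pairs of `S`-adjacent chambers
swapped by `t`.  Two walls are *parallel* iff these sets are disjoint. -/
def wall {B W : Type*} [Group W] {M : CoxeterMatrix B} (cs : CoxeterSystem M W) (t : W) :
    Set (W × W) :=
  {p | p.2 = t * p.1 ∧ ∃ i : B, p.2 = p.1 * cs.simple i}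

/-- The wall of the reflection `t` separates the chambers `x` and `y`. -/
def Separates {B W : Type*} [Group W] {M : CoxeterMatrix B} (cs : CoxeterSystem M W)
    (t x y : W) : Prop :=
  cs.length (x⁻¹ * t * y) < cs.length (x⁻¹ * y)

/-- The chamber `w` is adjacent to the wall of the reflection `t`. -/
def AdjWall {B W : Type*} [Group W] {M : CoxeterMatrix B} (cs : CoxeterSystem M W)
    (t w : W) : Prop :=
  ∃ i : B, w⁻¹ * t * w = cs.simple i

namespace ParallelWall

section Form

variable {V : Type*} [AddCommGroup V] [Module ℝ V] (F : LinearMap.BilinForm ℝ V)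

/-- The orthogonal reflection in a vector of norm one. -/
def refl (u : V) : Module.End ℝ V :=
  LinearMap.id - (2 : ℝ) • (F u).smulRight u

variable {F}

lemma refl_apply (u v : V) : refl F u v = v - (2 * F u v) • u := by
  simp [refl, mul_smul]

lemma refl_refl {u : V} (hu : F u u = 1) (v : V) : refl F u (refl F u v) = v := by
  simp only [refl_apply, map_sub, map_smul, hu]
  module

lemma refl_mul_refl {u : V} (hu : F u u = 1) : refl F u * refl F u = 1 :=
  LinearMap.ext fun v => refl_refl hu v

lemma form_refl (hF : ∀ u v, F u v = F v u) {u : V} (hu : F u u = 1) (v v' : V) :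
    F (refl F u v) (refl F u v') = F v v' := by
  simp only [refl_apply, map_sub, map_smul, LinearMap.sub_apply, LinearMap.smul_apply, hu,
    smul_eq_mul, hF v u]
  ring

lemma form_self_refl {u : V} (hu : F u u = 1) (v : V) : F u (refl F u v) = - F u v := by
  simp only [refl_apply, map_sub, map_smul, hu, smul_eq_mul]
  ring

/-- Powers of a product of two reflections act as rotations of the plane of the two vectors. -/
lemma refl_mul_refl_pow_apply (hF : ∀ u v, F u v = F v u) {a d : V} (ha : F a a = 1)
    (hd : F d d = 1) (had : F a d = 0) (ψ : ℝ) (k : ℕ) (v : V) :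
    ((refl F a * refl F (Real.cos ψ • a + Real.sin ψ • d)) ^ k) v =
      v + (Real.cos (k * (2 * ψ)) - 1) • (F a v • a + F d v • d)
        + Real.sin (k * (2 * ψ)) • (F d v • a - F a v • d) := by
  have hda : F d a = 0 := by rw [hF, had]
  induction k with
  | zero => simp
  | succ k ih =>
    rw [pow_succ', Module.End.mul_apply, ih, Module.End.mul_apply]
    have e : ((k + 1 : ℕ) : ℝ) * (2 * ψ) = k * (2 * ψ) + 2 * ψ := by push_cast; ring
    rw [e, Real.cos_add, Real.sin_add, Real.cos_two_mul, Real.sin_two_mul]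
    simp only [refl_apply, map_sub, map_add, map_smul, LinearMap.add_apply, LinearMap.smul_apply,
      ha, hd, had, hda, smul_eq_mul]
    generalize Real.cos (k * (2 * ψ)) = C
    generalize Real.sin (k * (2 * ψ)) = T
    have h2 : Real.sin ψ ^ 2 = 1 - Real.cos ψ ^ 2 := by
      linarith [Real.sin_sq_add_cos_sq ψ]
    match_scalars
    · grind
    · ring
    · linear_combination (2 * T * F a v - 2 * C * F d v) * h2

end Form

open CoxeterSystem

variable {B W : Type*} [Group W] {M : CoxeterMatrix B} [Fintype B] [DecidableEq B]

/-- The simple root of index `i`. -/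
def e (i : B) : B → ℝ := Pi.single i 1

variable (M) in
/-- The canonical bilinear form of a Coxeter matrix. -/
noncomputable def form : LinearMap.BilinForm ℝ (B → ℝ) :=
  Matrix.toBilin' (Matrix.of fun i j => - Real.cos (Real.pi / M i j))

lemma form_e (i j : B) : form M (e i) (e j) = - Real.cos (Real.pi / M i j) := by
  simp [form, e, Matrix.toBilin'_single]

lemma form_comm (u v : B → ℝ) : form M u v = form M v u := by
  simp only [form, Matrix.toBilin'_apply, Matrix.of_apply]
  rw [Finset.sum_comm]
  refine Finset.sum_congr rfl fun i _ => Finset.sum_congr rfl fun j _ => ?_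
  rw [M.symmetric i j]
  ring

lemma form_e_self (i : B) : form M (e i) (e i) = 1 := by
  simp [form_e]

omit [Fintype B] [DecidableEq B] in
lemma two_le_of_ne {i j : B} (h : i ≠ j) (h0 : M i j ≠ 0) : 2 ≤ M i j := by
  have := M.off_diagonal i j h
  omega

lemma form_e_nonpos {i j : B} (h : i ≠ j) : form M (e i) (e j) ≤ 0 := by
  rw [form_e, neg_nonpos]
  by_cases h0 : M i j = 0
  · simp [h0]
  · have h2 : (2 : ℝ) ≤ M i j := by exact_mod_cast two_le_of_ne h h0
    apply Real.cos_nonneg_of_mem_Icc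
    constructor
    · have : 0 ≤ Real.pi / M i j := by positivity
      linarith [Real.pi_pos]
    · exact div_le_div_of_nonneg_left Real.pi_pos.le two_pos h2

lemma eq_sum_e (v : B → ℝ) : v = ∑ i, v i • e i := by
  ext j
  simp [e, Pi.single_apply]

lemma form_eq_sum (u v : B → ℝ) : form M u v = ∑ i, u i * form M (e i) v := by
  conv_lhs => rw [eq_sum_e u]
  simp

lemma isLiftable_refl : M.IsLiftable fun i => refl (form M) (e i) := by
  intro i j
  by_cases hij : i = j
  · subst hij
    simp [refl_mul_refl (form_e_self i)]
  by_cases h0 : M i j = 0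
  · simp [h0]
  have h2 : (2 : ℝ) ≤ M i j := by exact_mod_cast two_le_of_ne hij h0
  set ψ := Real.pi - Real.pi / M i j with hψ
  have hs : 0 < Real.sin ψ := by
    rw [hψ, Real.sin_pi_sub]
    apply Real.sin_pos_of_pos_of_lt_pi (by positivity)
    exact div_lt_self Real.pi_pos (by linarith)
  have hc : form M (e i) (e j) = Real.cos ψ := by rw [form_e, hψ, Real.cos_pi_sub]
  set d : B → ℝ := (Real.sin ψ)⁻¹ • (e j - Real.cos ψ • e i) with hd
  have hed : e j = Real.cos ψ • e i + Real.sin ψ • d := by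
    rw [hd, smul_smul, mul_inv_cancel₀ hs.ne', one_smul]
    abel
  have h1 : form M (e i) d = 0 := by
    simp [hd, hc, form_e_self]
  have h3 : form M d d = 1 := by
    simp only [hd, map_smul, map_sub, LinearMap.smul_apply, LinearMap.sub_apply, form_e_self,
      form_comm (e j) (e i), hc, smul_eq_mul]
    field_simp
    linarith [Real.sin_sq_add_cos_sq ψ]
  apply LinearMap.ext
  intro v
  beta_reduce
  rw [hed, refl_mul_refl_pow_apply form_comm (form_e_self i) h3 h1]
  have hm : (M i j : ℝ) * (2 * ψ) = ((M i j - 1 : ℤ) : ℝ) * (2 * Real.pi) := by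
    rw [hψ]
    push_cast
    field_simp
  rw [hm, Real.cos_int_mul_two_pi, show ((M i j - 1 : ℤ) : ℝ) * (2 * Real.pi)
    = ((2 * (M i j - 1) : ℤ) : ℝ) * Real.pi by push_cast; ring, Real.sin_int_mul_pi]
  simp

variable (cs : CoxeterSystem M W)

/-- The geometric representation. -/
noncomputable def rep : W →* Module.End ℝ (B → ℝ) := cs.lift ⟨_, isLiftable_refl⟩

lemma rep_simple (i : B) : rep cs (cs.simple i) = refl (form M) (e i) :=
  cs.lift_apply_simple _ i

lemma rep_mul (w w' : W) (v : B → ℝ) : rep cs (w * w') v = rep cs w (rep cs w' v) := by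
  rw [map_mul, Module.End.mul_apply]

@[simp] lemma rep_inv_rep (w : W) (v : B → ℝ) : rep cs w⁻¹ (rep cs w v) = v := by
  rw [← rep_mul, inv_mul_cancel, map_one, Module.End.one_apply]

@[simp] lemma rep_rep_inv (w : W) (v : B → ℝ) : rep cs w (rep cs w⁻¹ v) = v := by
  rw [← rep_mul, mul_inv_cancel, map_one, Module.End.one_apply]

lemma rep_injective (w : W) : Function.Injective (rep cs w) :=
  Function.LeftInverse.injective (rep_inv_rep cs w)

lemma form_rep (w : W) (u v : B → ℝ) : form M (rep cs w u) (rep cs w v) = form M u v := by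
  induction w using cs.simple_induction_left with
  | one => simp
  | mul_simple_left w i ih => rw [rep_mul, rep_mul, rep_simple,
      form_refl form_comm (form_e_self i), ih]

lemma form_rep_left (w : W) (u v : B → ℝ) : form M (rep cs w u) v = form M u (rep cs w⁻¹ v) := by
  rw [← form_rep cs w u, rep_rep_inv]

/-- The Chebyshev-type sequence of coefficients of the roots of a dihedral group. -/
def dihedralCoeff (c : ℝ) : ℕ → ℝ
  | 0 => 0
  | 1 => 1
  | k + 2 => 2 * c * dihedralCoeff c (k + 1) - dihedralCoeff c k

lemma dihedralCoeff_mul_sin (θ : ℝ) (k : ℕ) :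
    dihedralCoeff (Real.cos θ) k * Real.sin θ = Real.sin (k * θ) := by
  induction k using Nat.twoStepInduction with
  | zero => simp [dihedralCoeff]
  | one => simp [dihedralCoeff]
  | more k ih1 ih2 =>
    rw [dihedralCoeff, sub_mul, mul_assoc, ih1, ih2]
    have h1 : ((k + 2 : ℕ) : ℝ) * θ = (k + 1 : ℕ) * θ + θ := by push_cast; ring
    have h2 : (k : ℝ) * θ = (k + 1 : ℕ) * θ - θ := by push_cast; ring
    rw [h1, h2, Real.sin_add, Real.sin_sub]
    ring

lemma dihedralCoeff_one (k : ℕ) : dihedralCoeff 1 k = k := by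
  induction k using Nat.twoStepInduction with
  | zero => simp [dihedralCoeff]
  | one => simp [dihedralCoeff]
  | more k ih1 ih2 =>
    rw [dihedralCoeff, ih1, ih2]
    push_cast
    ring

omit [Fintype B] [DecidableEq B] in
lemma dihedralCoeff_nonneg {i j : B} (hij : i ≠ j) {k : ℕ} (hk : M i j ≠ 0 → k ≤ M i j) :
    0 ≤ dihedralCoeff (Real.cos (Real.pi / M i j)) k := by
  by_cases h0 : M i j = 0
  · simp [h0, dihedralCoeff_one]
  have h2 : (2 : ℝ) ≤ M i j := by exact_mod_cast two_le_of_ne hij h0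
  have hs : 0 < Real.sin (Real.pi / M i j) := by
    apply Real.sin_pos_of_pos_of_lt_pi (by positivity)
    exact div_lt_self Real.pi_pos (by linarith)
  refine nonneg_of_mul_nonneg_left ?_ hs
  rw [dihedralCoeff_mul_sin]
  apply Real.sin_nonneg_of_nonneg_of_le_pi (by positivity)
  have : (k : ℝ) ≤ M i j := by exact_mod_cast hk h0
  rw [mul_div_assoc', div_le_iff₀ (by linarith)]
  nlinarith [Real.pi_pos]

lemma refl_e_e (i j : B) :
    refl (form M) (e i) (e j) = e j + (2 * Real.cos (Real.pi / M i j)) • e i := by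
  rw [refl_apply, form_e]
  module

lemma rep_alternatingWord (i j : B) (k : ℕ) :
    rep cs (cs.wordProd (alternatingWord i j k)) (e i) =
      if Even k then dihedralCoeff (Real.cos (Real.pi / M i j)) (k + 1) • e i
        + dihedralCoeff (Real.cos (Real.pi / M i j)) k • e j
      else dihedralCoeff (Real.cos (Real.pi / M i j)) k • e i
        + dihedralCoeff (Real.cos (Real.pi / M i j)) (k + 1) • e j := by
  induction k with
  | zero => simp [alternatingWord, dihedralCoeff]
  | succ k ih =>
    rw [alternatingWord_succ', wordProd_cons, rep_mul, ih]
    have hi : refl (form M) (e i) (e i) = -e i := by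
      rw [refl_apply, form_e_self]; module
    have hj : refl (form M) (e j) (e j) = -e j := by
      rw [refl_apply, form_e_self]; module
    by_cases hk : Even k
    · have hk' : ¬ Even (k + 1) := by simpa [Nat.even_add_one] using hk
      simp only [hk, hk', if_true, if_false, rep_simple, map_add, map_smul, hj, refl_e_e,
        M.symmetric j i, dihedralCoeff]
      module
    · have hk' : Even (k + 1) := by simpa [Nat.even_add_one] using hk
      simp only [hk, hk', if_true, if_false, rep_simple, map_add, map_smul, hi, refl_e_e,
        dihedralCoeff]
      module

omit [Fintype B] in
lemma e_nonneg (i : B) : (0 : B → ℝ) ≤ e i := Pi.single_nonneg.2 zero_le_one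

lemma rep_e_nonneg {w : W} {i : B} (h : cs.length w < cs.length (w * cs.simple i)) :
    0 ≤ rep cs w (e i) := by
  induction hn : cs.length w using Nat.strong_induction_on generalizing w i with
  | _ n ih =>
  subst hn
  by_cases hw : w = 1
  · subst hw
    simpa using e_nonneg i
  obtain ⟨j, hj⟩ := cs.exists_rightDescent_of_ne_one hw
  have hij : i ≠ j := by
    rintro rfl
    exact lt_asymm h hj
  set u : ℕ → W := fun k => cs.wordProd (alternatingWord i j k) with hu
  have hus (k : ℕ) : u (k + 1) = cs.simple (if Even k then j else i) * u k := by
    simp only [hu]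
    rw [alternatingWord_succ', wordProd_cons]
  have hex : ∃ n, ¬ cs.length (w * (u n)⁻¹) + n = cs.length w :=
    ⟨cs.length w + 1, by omega⟩
  classical
  have hmin := fun m => Nat.find_min (m := m) hex
  have hspec := Nat.find_spec hex
  set n := Nat.find hex
  have hn1 : 2 ≤ n := by
    by_contra hlt
    apply hspec
    have : n = 0 ∨ n = 1 := by omega
    obtain h0 | h0 := this
    · simp [h0, hu, alternatingWord]
    · have := cs.isRightDescent_iff.1 hj
      simpa [h0, hu, alternatingWord] using this
  obtain ⟨k, hk⟩ : ∃ k, n = k + 2 := ⟨n - 2, by omega⟩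
  rw [hk] at hspec hmin
  have hP (m : ℕ) (hm : m < k + 2) : cs.length (w * (u m)⁻¹) + m = cs.length w :=
    not_not.1 (hmin m hm)
  set v := w * (u (k + 1))⁻¹ with hv
  have hvl : cs.length v + (k + 1) = cs.length w := hP (k + 1) (by omega)
  have h1 : cs.length v < cs.length (v * cs.simple (if Even (k + 1) then j else i)) := by
    have hv2 : w * (u (k + 2))⁻¹ = v * cs.simple (if Even (k + 1) then j else i) := by
      rw [hus (k + 1), hv, mul_inv_rev, inv_simple, mul_assoc]
    rw [hv2] at hspec
    have := cs.length_mul_simple v (if Even (k + 1) then j else i)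
    omega
  have h2 : cs.length v < cs.length (v * cs.simple (if Even k then j else i)) := by
    have hv2 : w * (u k)⁻¹ = v * cs.simple (if Even k then j else i) := by
      rw [hv, hus k, mul_inv_rev, inv_simple, mul_assoc, mul_assoc, simple_mul_simple_self,
        mul_one]
    have := hP k (by omega)
    rw [hv2] at this
    omega
  have hwv : w = v * u (k + 1) := by rw [hv, inv_mul_cancel_right]
  have hij2 : 0 ≤ rep cs v (e i) ∧ 0 ≤ rep cs v (e j) := by
    have h1' := ih _ (by omega) h1 rfl
    have h2' := ih _ (by omega) h2 rfl
    by_cases hek : Even k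
    · have hk' : ¬ Even (k + 1) := by simpa [Nat.even_add_one] using hek
      rw [if_pos hek] at h2'
      rw [if_neg hk'] at h1'
      exact ⟨h1', h2'⟩
    · have hk' : Even (k + 1) := by simpa [Nat.even_add_one] using hek
      rw [if_neg hek] at h2'
      rw [if_pos hk'] at h1'
      exact ⟨h2', h1'⟩
  have hkM : M i j ≠ 0 → k + 2 ≤ M i j := by
    intro h0
    by_contra hlt
    obtain ⟨m, hm⟩ := Nat.exists_eq_succ_of_ne_zero h0
    have hPm := hP (M i j) (by omega)
    have hum : u (M i j) = u m * cs.simple i := by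
      have := cs.wordProd_braidWord_eq i j
      simp only [hu]
      rw [braidWord, braidWord, M.symmetric j i] at this
      rw [this, hm, alternatingWord_succ, wordProd_concat]
    have hwi : w * cs.simple i = (w * (u (M i j))⁻¹) * u m := by
      rw [hum]
      simp [mul_assoc]
    have := cs.length_mul_le (w * (u (M i j))⁻¹) (u m)
    have hl : cs.length (u m) ≤ m := by
      simpa using cs.length_wordProd_le (alternatingWord i j m)
    rw [← hwi] at this
    omega
  have hc1 := dihedralCoeff_nonneg (M := M) hij (k := k + 1) (fun h => by have := hkM h; omega)
  have hc2 := dihedralCoeff_nonneg (M := M) hij (k := k + 2) hkM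
  rw [hwv, rep_mul, hu]
  beta_reduce
  rw [rep_alternatingWord]
  split_ifs
  · simp only [map_add, map_smul]
    exact add_nonneg (smul_nonneg hc2 hij2.1) (smul_nonneg hc1 hij2.2)
  · simp only [map_add, map_smul]
    exact add_nonneg (smul_nonneg hc1 hij2.1) (smul_nonneg hc2 hij2.2)

lemma rep_e_nonpos {w : W} {i : B} (h : cs.length (w * cs.simple i) < cs.length w) :
    rep cs w (e i) ≤ 0 := by
  have h1 : 0 ≤ rep cs (w * cs.simple i) (e i) := rep_e_nonneg cs (by simpa using h)
  have h2 : rep cs (w * cs.simple i) (e i) = - rep cs w (e i) := by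
    rw [rep_mul, rep_simple, refl_apply, form_e_self, ← map_neg]
    congr 1
    module
  rw [h2] at h1
  exact neg_nonneg.1 h1

/-- The roots: images of simple roots under the geometric representation. -/
def IsRoot (α : B → ℝ) : Prop := ∃ w i, α = rep cs w (e i)

/-- The roots that are nonnegative combinations of simple roots. -/
def IsPosRoot (α : B → ℝ) : Prop := IsRoot cs α ∧ 0 ≤ α

variable {cs} {α β : B → ℝ}

lemma isRoot_e (i : B) : IsRoot cs (e i) := ⟨1, i, by simp⟩

lemma isPosRoot_e (i : B) : IsPosRoot cs (e i) := ⟨isRoot_e i, e_nonneg i⟩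

lemma IsRoot.image (h : IsRoot cs α) (w : W) : IsRoot cs (rep cs w α) := by
  obtain ⟨v, i, rfl⟩ := h
  exact ⟨w * v, i, by rw [rep_mul]⟩

lemma IsRoot.neg (h : IsRoot cs α) : IsRoot cs (-α) := by
  obtain ⟨v, i, rfl⟩ := h
  refine ⟨v * cs.simple i, i, ?_⟩
  rw [rep_mul, rep_simple, refl_apply, form_e_self, ← map_neg]
  congr 1
  module

lemma IsRoot.form_self (h : IsRoot cs α) : form M α α = 1 := by
  obtain ⟨v, i, rfl⟩ := h
  rw [form_rep, form_e_self]

lemma IsRoot.ne_zero (h : IsRoot cs α) : α ≠ 0 := by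
  rintro rfl
  simpa using h.form_self

lemma IsRoot.nonneg_or_nonpos (h : IsRoot cs α) : 0 ≤ α ∨ α ≤ 0 := by
  obtain ⟨v, i, rfl⟩ := h
  rcases lt_or_gt_of_ne (cs.length_mul_simple_ne v i) with h | h
  · exact Or.inr (rep_e_nonpos cs h)
  · exact Or.inl (rep_e_nonneg cs h)

lemma IsRoot.not_nonpos_iff (h : IsRoot cs α) : ¬ α ≤ 0 ↔ 0 ≤ α := by
  constructor
  · intro h1
    exact h.nonneg_or_nonpos.resolve_right h1
  · intro h1 h2
    exact h.ne_zero (le_antisymm h2 h1)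

lemma IsRoot.not_nonneg_iff (h : IsRoot cs α) : ¬ 0 ≤ α ↔ α ≤ 0 := by
  rw [← h.not_nonpos_iff, not_not]

lemma IsRoot.nonneg_of_pos (h : IsRoot cs α) {j : B} (hj : 0 < α j) : 0 ≤ α :=
  h.not_nonpos_iff.1 fun h1 => (h1 j).not_gt hj

lemma eq_one_of_rep_eq_one {w : W} (h : rep cs w = 1) : w = 1 := by
  by_contra hw
  obtain ⟨i, hi⟩ := cs.exists_rightDescent_of_ne_one hw
  have := rep_e_nonpos cs hi
  rw [h, Module.End.one_apply] at this
  exact (isRoot_e (cs := cs) i).not_nonpos_iff.2 (e_nonneg i) this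

lemma eq_of_rep_eq {w w' : W} (h : rep cs w = rep cs w') : w = w' := by
  have : rep cs (w * w'⁻¹) = 1 := by
    rw [map_mul, h, ← map_mul, mul_inv_cancel, map_one]
  exact mul_inv_eq_one.1 (eq_one_of_rep_eq_one this)

lemma rep_conj_refl {t : W} (ht : rep cs t = refl (form M) α) (w : W) :
    rep cs (w * t * w⁻¹) = refl (form M) (rep cs w α) := by
  apply LinearMap.ext
  intro v
  rw [rep_mul, rep_mul, ht, refl_apply, refl_apply, map_sub, map_smul, form_rep_left, rep_rep_inv]

lemma IsRoot.exists_reflection (h : IsRoot cs α) :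
    ∃ t, cs.IsReflection t ∧ rep cs t = refl (form M) α := by
  obtain ⟨w, i, rfl⟩ := h
  exact ⟨_, ⟨w, i, rfl⟩, rep_conj_refl (rep_simple cs i) w⟩

lemma exists_isPosRoot {t : W} (ht : cs.IsReflection t) :
    ∃ α, IsPosRoot cs α ∧ rep cs t = refl (form M) α := by
  obtain ⟨w, i, rfl⟩ := ht
  have h1 := rep_conj_refl (rep_simple cs i) w
  have hr : IsRoot cs (rep cs w (e i)) := ⟨w, i, rfl⟩
  rcases hr.nonneg_or_nonpos with h | h
  · exact ⟨_, ⟨hr, h⟩, h1⟩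
  · refine ⟨_, ⟨hr.neg, neg_nonneg.2 h⟩, h1.trans ?_⟩
    apply LinearMap.ext
    intro v
    simp [refl_apply]

lemma IsRoot.reflect (hα : IsRoot cs α) (hβ : IsRoot cs β) : IsRoot cs (refl (form M) α β) := by
  obtain ⟨t, -, ht⟩ := hα.exists_reflection
  rw [← ht]
  exact hβ.image t

/-- Two positive roots with the same reflection coincide. -/
lemma IsPosRoot.eq_of_refl_eq (hα : IsPosRoot cs α) (hβ : IsPosRoot cs β)
    (h : refl (form M) α = refl (form M) β) : α = β := by
  have h1 := LinearMap.congr_fun h α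
  rw [refl_apply, refl_apply, hα.1.form_self] at h1
  have h2 : α = form M β α • β := by
    have h3 : (2 : ℝ) • α = (2 : ℝ) • (form M β α • β) := by
      rw [smul_smul]
      simpa using h1
    exact smul_right_injective _ two_ne_zero h3
  have h3 := hα.1.form_self
  set c := form M β α with hc
  rw [h2] at h3
  simp only [map_smul, LinearMap.smul_apply, hβ.1.form_self, smul_eq_mul, mul_one] at h3
  have h4 : c = 1 ∨ c = -1 := mul_self_eq_one_iff.1 h3
  rcases h4 with h4 | h4
  · rw [h2, h4, one_smul]
  · exfalso
    rw [h4] at h2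
    refine hα.1.not_nonneg_iff.2 ?_ hα.2
    rw [h2]
    simpa using hβ.2

lemma refl_e_apply_of_ne {i j : B} (h : j ≠ i) (v : B → ℝ) :
    refl (form M) (e i) v j = v j := by
  simp [refl_apply, e, h]

/-- A positive root other than a given simple one involves another simple root. -/
lemma IsPosRoot.exists_pos (hα : IsPosRoot cs α) {i : B} (hi : α ≠ e i) :
    ∃ j, j ≠ i ∧ 0 < α j := by
  by_contra hcon
  push Not at hcon
  have h1 : α = α i • e i := by
    ext j
    by_cases hj : j = i
    · subst hj; simp [e]
    · simpa [e, hj] using le_antisymm (hcon j hj) (hα.2 j)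
  have h2 := hα.1.form_self
  have h3 := hα.2 i
  set c := α i with hc
  rw [h1] at h2
  simp only [map_smul, LinearMap.smul_apply, form_e_self, smul_eq_mul, mul_one] at h2
  rcases mul_self_eq_one_iff.1 h2 with h4 | h4
  · exact hi (by rw [h1, h4, one_smul])
  · simp only [Pi.zero_apply] at h3
    linarith

lemma IsPosRoot.reflect (hα : IsPosRoot cs α) {i : B} (hi : α ≠ e i) :
    IsPosRoot cs (refl (form M) (e i) α) := by
  obtain ⟨j, hj, hj'⟩ := hα.exists_pos hi
  have := (isRoot_e i).reflect hα.1
  refine ⟨this, this.nonneg_of_pos (j := j) ?_⟩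
  rwa [refl_e_apply_of_ne hj]

lemma refl_e_self (i : B) : refl (form M) (e i) (e i) = - e i := by
  rw [refl_apply, form_e_self]
  module

/-- A group element makes only finitely many positive roots negative. -/
lemma finite_inversions (w : W) : {γ | IsPosRoot cs γ ∧ rep cs w γ ≤ 0}.Finite := by
  induction w using cs.simple_induction_right with
  | one =>
    convert Set.finite_empty
    ext γ
    simp only [map_one, Module.End.one_apply, Set.mem_ofPred_eq, Set.mem_empty_iff_false, iff_false]
    rintro ⟨h1, h2⟩
    exact h1.1.not_nonpos_iff.2 h1.2 h2
  | mul_simple_right w i ih =>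
    refine ((ih.image (refl (form M) (e i))).union (Set.finite_singleton (e i))).subset ?_
    rintro γ ⟨h1, h2⟩
    by_cases hγ : γ = e i
    · exact Or.inr hγ
    · left
      refine ⟨refl (form M) (e i) γ, ⟨h1.reflect hγ, ?_⟩, refl_refl (form_e_self i) γ⟩
      rwa [rep_mul, rep_simple] at h2

lemma rep_nonneg_of_length_lt {t : W} (hα : IsPosRoot cs α)
    (ht : rep cs t = refl (form M) α) {w : W} (h : cs.length w < cs.length (w * t)) :
    0 ≤ rep cs w α := by
  induction hn : cs.length w using Nat.strong_induction_on generalizing w with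
  | _ n ih =>
  subst hn
  by_cases hw : w = 1
  · subst hw
    simpa using hα.2
  obtain ⟨i, hi⟩ := cs.exists_leftDescent_of_ne_one hw
  have hi' := cs.isLeftDescent_iff.1 hi
  have h1 := cs.length_simple_mul (w * t) i
  have h2 : 0 ≤ rep cs (cs.simple i * w) α := by
    refine ih _ hi ?_ rfl
    rw [mul_assoc]
    omega
  have h3 : IsPosRoot cs (rep cs (cs.simple i * w) α) := ⟨hα.1.image _, h2⟩
  by_cases h4 : rep cs (cs.simple i * w) α = e i
  · exfalso
    have h5 := rep_conj_refl ht (cs.simple i * w)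
    rw [h4, ← rep_simple cs i] at h5
    have h6 := eq_of_rep_eq h5
    have h7 : w * t = cs.simple i * w := by
      have h8 := mul_inv_eq_iff_eq_mul.1 h6
      rw [mul_assoc] at h8
      exact mul_left_cancel h8
    rw [h7] at h
    exact lt_asymm h hi
  · have := h3.reflect h4
    rw [← rep_simple cs i, ← rep_mul] at this
    simpa using this.2

lemma length_lt_of_rep_inv_nonpos {t : W} (hα : IsPosRoot cs α) (hr : cs.IsReflection t)
    (ht : rep cs t = refl (form M) α) {w : W} (h : rep cs w⁻¹ α ≤ 0) :
    cs.length (t * w) < cs.length w := by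
  refine lt_of_le_of_ne (not_lt.1 fun h1 => ?_) (hr.length_mul_right_ne w)
  refine (hα.1.image w⁻¹).not_nonneg_iff.2 h (rep_nonneg_of_length_lt hα ht ?_)
  rw [cs.length_inv, ← cs.length_inv (w⁻¹ * t)]
  simpa [hr.inv] using h1

variable (cs) in
/-- Dominance of roots: `α` dominates `β` if every element making `α` negative makes `β`
negative. -/
def Dominates (α β : B → ℝ) : Prop := ∀ w, rep cs w α ≤ 0 → rep cs w β ≤ 0

lemma dihedralCoeff_succ_ge {c : ℝ} (hc : 1 ≤ c) (k : ℕ) :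
    0 ≤ dihedralCoeff c k ∧ dihedralCoeff c k + 1 ≤ dihedralCoeff c (k + 1) := by
  induction k with
  | zero => simp [dihedralCoeff]
  | succ k ih =>
    rw [dihedralCoeff]
    constructor
    · linarith
    · nlinarith [mul_nonneg (sub_nonneg.2 hc) (show 0 ≤ dihedralCoeff c (k + 1) by linarith)]

lemma isRoot_dihedral (hα : IsRoot cs α) (hβ : IsRoot cs β) (n : ℕ) :
    IsRoot cs (dihedralCoeff (form M α β) (2 * n + 1) • α
      - dihedralCoeff (form M α β) (2 * n) • β) := by
  induction n with
  | zero => simpa [dihedralCoeff] using hα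
  | succ n ih =>
    convert hα.reflect (hβ.reflect ih) using 1
    simp only [refl_apply, map_sub, map_smul, hα.form_self, hβ.form_self, form_comm β α,
      mul_add, mul_one, add_assoc]
    norm_num only
    simp only [dihedralCoeff]
    match_scalars <;> ring

/-- Two positive roots whose product is at least one are comparable for dominance. -/
lemma IsPosRoot.dominates_or_dominates (hα : IsPosRoot cs α) (hβ : IsPosRoot cs β)
    (h : 1 ≤ form M α β) : Dominates cs α β ∨ Dominates cs β α := by
  by_contra hcon
  simp only [Dominates] at hcon
  push Not at hcon
  obtain ⟨⟨w, hwα, hwβ⟩, ⟨w', hwβ', hwα'⟩⟩ := hcon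
  rw [(hβ.1.image w).not_nonpos_iff] at hwβ
  rw [(hα.1.image w').not_nonpos_iff] at hwα'
  set p := dihedralCoeff (form M α β) with hp
  have hp0 (k : ℕ) : 0 ≤ p k := (dihedralCoeff_succ_ge h k).1
  have hmono : StrictMono p :=
    strictMono_nat_of_lt_succ fun k => by linarith [(dihedralCoeff_succ_ge h k).2]
  set γ : ℕ → B → ℝ := fun n => p (2 * n + 1) • α - p (2 * n) • β with hγ
  have hγr (n : ℕ) : IsRoot cs (γ n) := isRoot_dihedral hα.1 hβ.1 n
  have hneg (n : ℕ) : rep cs w (γ n) ≤ 0 := by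
    simp only [hγ, map_sub, map_smul]
    exact sub_nonpos.2 ((smul_nonpos_of_nonneg_of_nonpos (hp0 _) hwα).trans
      (smul_nonneg (hp0 _) hwβ))
  have hpos (n : ℕ) : 0 ≤ rep cs w' (γ n) := by
    simp only [hγ, map_sub, map_smul]
    exact sub_nonneg.2 ((smul_nonpos_of_nonneg_of_nonpos (hp0 _) hwβ').trans
      (smul_nonneg (hp0 _) hwα'))
  obtain ⟨j, hj⟩ : ∃ j, rep cs w α j < 0 := by
    by_contra hcon
    push Not at hcon
    exact (hα.1.image w).not_nonneg_iff.2 hwα hcon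
  have hanti : StrictAnti fun n => rep cs w (γ n) j := by
    intro m n hmn
    simp only [hγ, map_sub, map_smul, Pi.sub_apply, Pi.smul_apply, smul_eq_mul]
    have h1 : p (2 * m + 1) < p (2 * n + 1) := hmono (by omega)
    have h2 : p (2 * m) < p (2 * n) := hmono (by omega)
    have h3 : 0 ≤ rep cs w β j := hwβ j
    nlinarith
  have hinj : Function.Injective γ := fun m n hmn => hanti.injective (by simp only [hmn])
  refine Set.infinite_of_injective_forall_mem ((rep_injective cs w').comp hinj) (fun n => ?_)
    (finite_inversions (cs := cs) (w * w'⁻¹))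
  refine ⟨⟨(hγr n).image w', hpos n⟩, ?_⟩
  rw [rep_mul, Function.comp_apply, rep_inv_rep]
  exact hneg n

variable (cs) in
/-- Elementary roots: positive roots dominating no other positive root. -/
def IsElementary (α : B → ℝ) : Prop :=
  IsPosRoot cs α ∧ ∀ β, IsPosRoot cs β → Dominates cs α β → β = α

lemma IsElementary.form_lt_one (hα : IsElementary cs α) {i : B} (hi : α ≠ e i) :
    form M (e i) α < 1 := by
  by_contra hcon
  push Not at hcon
  rcases (isPosRoot_e i).dominates_or_dominates hα.1 hcon with h | h
  · have h1 := h (cs.simple i)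
    rw [rep_simple, refl_e_self] at h1
    have h2 := h1 (neg_nonpos.2 (e_nonneg i))
    exact (hα.1.reflect hi).1.not_nonpos_iff.2 (hα.1.reflect hi).2 h2
  · exact hi (hα.2 _ (isPosRoot_e i) h).symm

lemma IsElementary.reflect (hα : IsElementary cs α) {i : B} (hi : α ≠ e i)
    (h : 0 < form M (e i) α) : IsElementary cs (refl (form M) (e i) α) := by
  refine ⟨hα.1.reflect hi, fun β hβ hdom => ?_⟩
  by_cases hβi : β = e i
  · exfalso
    subst hβi
    obtain ⟨t, -, ht⟩ := hα.1.1.exists_reflection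
    have h1 := hdom (t * cs.simple i)
    rw [rep_mul, rep_mul, rep_simple, refl_refl (form_e_self i), ht, refl_e_self, map_neg] at h1
    have h2 : refl (form M) α α = -α := by
      rw [refl_apply, hα.1.1.form_self]; module
    rw [h2] at h1
    have h3 := neg_nonpos.1 (h1 (neg_nonpos.2 hα.1.2))
    obtain ⟨j, hj, hj'⟩ := hα.1.exists_pos hi
    have h4 := h3 j
    simp only [refl_apply, e, Pi.zero_apply, Pi.sub_apply, Pi.single_apply, hj, if_false,
      Pi.smul_apply, smul_eq_mul] at h4
    rw [form_comm] at h4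
    have : 0 < 2 * form M (e i) α * α j := by positivity
    simp only [e] at this
    linarith
  · have h1 : refl (form M) (e i) β = α := by
      refine hα.2 _ (hβ.reflect hβi) fun w hw => ?_
      have := hdom (w * cs.simple i)
      rw [rep_mul, rep_mul, rep_simple, refl_refl (form_e_self i)] at this
      exact this hw
    rw [← h1, refl_refl (form_e_self i)]

lemma exists_shorter (hα : IsPosRoot cs α) {i : B} (h : 0 < form M (e i) α)
    {w : W} (hw : rep cs w α ≤ 0) :
    ∃ w', cs.length w' < cs.length w ∧ rep cs w' (refl (form M) (e i) α) ≤ 0 := by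
  induction hn : cs.length w using Nat.strong_induction_on generalizing w with
  | _ n ih =>
  subst hn
  by_cases hwi : rep cs w (e i) ≤ 0
  · refine ⟨w * cs.simple i, ?_, ?_⟩
    · refine lt_of_le_of_ne (not_lt.1 fun h1 => ?_) (cs.length_mul_simple_ne w i)
      exact ((isRoot_e i).image w).not_nonneg_iff.2 hwi (rep_e_nonneg cs h1)
    · rwa [rep_mul, rep_simple, refl_refl (form_e_self i)]
  rw [((isRoot_e i).image w).not_nonpos_iff] at hwi
  have hw1 : w ≠ 1 := by
    rintro rfl
    rw [map_one, Module.End.one_apply] at hw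
    exact hα.1.not_nonpos_iff.2 hα.2 hw
  obtain ⟨j, hj⟩ := cs.exists_leftDescent_of_ne_one hw1
  by_cases hwα : rep cs (cs.simple j * w) α ≤ 0
  · obtain ⟨w', h1, h2⟩ := ih _ hj hwα rfl
    exact ⟨w', h1.trans hj, h2⟩
  refine ⟨cs.simple j * w, hj, ?_⟩
  rw [(hα.1.image _).not_nonpos_iff] at hwα
  have h1 : rep cs (cs.simple j * w) α = e j := by
    by_contra hne
    have h2 : IsPosRoot cs (rep cs (cs.simple j * w) α) := ⟨hα.1.image _, hwα⟩
    have h3 := h2.reflect hne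
    rw [← rep_simple cs, ← rep_mul, simple_mul_simple_cancel_left] at h3
    exact h3.1.not_nonpos_iff.2 h3.2 hw
  have h2 : rep cs w α = - e j := by
    rw [← refl_e_self (M := M) j, ← rep_simple cs, ← h1, ← rep_mul, simple_mul_simple_cancel_left]
  have h3 : rep cs w (refl (form M) (e i) α) = - (e j + (2 * form M (e i) α) • rep cs w (e i)) := by
    rw [refl_apply, map_sub, map_smul, h2]
    module
  have h4 : IsPosRoot cs (e j + (2 * form M (e i) α) • rep cs w (e i)) := by
    constructor
    · have h5 := (((isRoot_e i).reflect hα.1).image w).neg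
      rwa [h3, neg_neg] at h5
    · exact add_nonneg (e_nonneg j) (smul_nonneg (by positivity) hwi)
  have h5 : e j + (2 * form M (e i) α) • rep cs w (e i) ≠ e j := by
    intro h6
    have h7 := add_eq_left.1 h6
    rcases smul_eq_zero.1 h7 with h8 | h8
    · linarith
    · exact ((isRoot_e i).image w).ne_zero h8
  have h6 := (h4.reflect h5).2
  rw [rep_mul, h3, map_neg, rep_simple]
  exact neg_nonpos.2 h6

lemma IsPosRoot.exists_form_pos (hα : IsPosRoot cs α) : ∃ i, 0 < form M (e i) α := by
  by_contra hcon
  push Not at hcon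
  have h1 := hα.1.form_self
  rw [form_eq_sum] at h1
  have h2 := Finset.sum_nonpos fun i (_ : i ∈ Finset.univ) =>
    mul_nonpos_of_nonneg_of_nonpos (hα.2 i) (hcon i)
  linarith

variable (cs) in
/-- A chain of elementary roots `a 0, …, a n` starting at a simple root, each obtained from the
previous one by a simple reflection increasing it. -/
structure IsChain (n : ℕ) (a : ℕ → B → ℝ) : Prop where
  zero : ∃ i, a 0 = e i
  elementary : ∀ k ≤ n, IsElementary cs (a k)
  step : ∀ k < n, ∃ i, a (k + 1) = refl (form M) (e i) (a k) ∧
    -1 < form M (e i) (a k) ∧ form M (e i) (a k) < 0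

lemma IsElementary.exists_isChain (hα : IsElementary cs α) :
    ∃ n a, IsChain cs n a ∧ a n = α := by
  obtain ⟨w, hw⟩ : ∃ w, rep cs w α ≤ 0 := by
    obtain ⟨t, -, ht⟩ := hα.1.1.exists_reflection
    refine ⟨t, ?_⟩
    rw [ht, refl_apply, hα.1.1.form_self, show α - ((2 : ℝ) * 1) • α = -α by module]
    exact neg_nonpos.2 hα.1.2
  induction hn : cs.length w using Nat.strong_induction_on generalizing w α with
  | _ n ih =>
  subst hn
  by_cases hs : ∃ i, α = e i
  · exact ⟨0, fun _ => α, ⟨hs, fun _ _ => hα, fun k hk => absurd hk (Nat.not_lt_zero k)⟩, rfl⟩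
  push Not at hs
  obtain ⟨i, hi⟩ := hα.1.exists_form_pos
  obtain ⟨w', hw', hneg⟩ := exists_shorter hα.1 hi hw
  obtain ⟨n, a, ha, han⟩ := ih _ hw' (hα.reflect (hs i) hi) w' hneg rfl
  refine ⟨n + 1, fun k => if k ≤ n then a k else α, ⟨?_, ?_, ?_⟩, by simp⟩
  · simpa using ha.zero
  · intro k hk
    split_ifs with hkn
    · exact ha.elementary k hkn
    · exact hα
  · intro k hk
    rcases Nat.lt_succ_iff_lt_or_eq.1 hk with hk' | rfl
    · simpa [hk'.le, Nat.succ_le_of_lt hk'] using ha.step k hk'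
    · refine ⟨i, ?_⟩
      simp only [le_refl, if_true, Nat.not_succ_le_self, if_false, han,
        refl_refl (form_e_self i), form_self_refl (form_e_self i), true_and]
      have := hα.form_lt_one (hs i)
      constructor <;> linarith

lemma IsChain.exists_rep_eq {n : ℕ} {a : ℕ → B → ℝ} (h : IsChain cs n a) {k : ℕ} (hk : k ≤ n) :
    ∃ w i, cs.length w ≤ k ∧ a k = rep cs w (e i) := by
  induction k with
  | zero =>
    obtain ⟨i, hi⟩ := h.zero
    exact ⟨1, i, by simp, by simpa using hi⟩
  | succ k ih =>
    obtain ⟨w, i, hw, hi⟩ := ih (by omega)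
    obtain ⟨j, hj, -⟩ := h.step k (by omega)
    refine ⟨cs.simple j * w, i, ?_, ?_⟩
    · have := cs.length_simple_mul w j
      omega
    · rw [hj, hi, rep_mul, rep_simple]

/-- If the powers of a rotation map a vector of a plane into the positive or negative orthant only,
then the rotation has finite order or the plane is degenerate. -/
lemma exists_cos_eq_one {ι : Type*} {θ : ℝ} {u v : ι → ℝ}
    (h : ∀ k : ℕ, 0 ≤ Real.cos (k * θ) • u - Real.sin (k * θ) • v ∨
      Real.cos (k * θ) • u - Real.sin (k * θ) • v ≤ 0) (hne : ∃ i j, u i * v j ≠ u j * v i) :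
    ∃ n : ℕ, 0 < n ∧ Real.cos (n * θ) = 1 ∧ Real.sin (n * θ) = 0 := by
  have : Fact (0 < 2 * Real.pi) := ⟨Real.two_pi_pos⟩
  by_cases hθ : addOrderOf (θ : AddCircle (2 * Real.pi)) = 0
  · exfalso
    obtain ⟨i, j, hij⟩ := hne
    apply hij
    have hd := denseRange_zsmul_iff_nsmul.1 (AddCircle.denseRange_zsmul_iff.2 hθ)
    have h1 (φ : Real.Angle) : 0 ≤ (φ.cos * u i - φ.sin * v i) * (φ.cos * u j - φ.sin * v j) := by
      refine DenseRange.induction_on (p := fun φ : Real.Angle =>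
        0 ≤ (φ.cos * u i - φ.sin * v i) * (φ.cos * u j - φ.sin * v j)) hd φ ?_ fun k => ?_
      · have := Real.Angle.continuous_cos
        have := Real.Angle.continuous_sin
        exact isClosed_le (by fun_prop) (by fun_prop)
      · have h2 : k • (θ : AddCircle (2 * Real.pi)) = ((k * θ : ℝ) : Real.Angle) :=
          (Real.Angle.natCast_mul_eq_nsmul θ k).symm
        simp only [h2, Real.Angle.cos_coe, Real.Angle.sin_coe]
        rcases h k with h3 | h3
        · have hi := h3 i
          have hj := h3 j
          simp only [Pi.zero_apply, Pi.sub_apply, Pi.smul_apply, smul_eq_mul] at hi hj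
          exact mul_nonneg hi hj
        · have hi := h3 i
          have hj := h3 j
          simp only [Pi.zero_apply, Pi.sub_apply, Pi.smul_apply, smul_eq_mul] at hi hj
          exact mul_nonneg_of_nonpos_of_nonpos hi hj
    have h2 (x : ℝ) : 0 ≤ v i * v j * (x * x) + -(u i * v j + u j * v i) * x + u i * u j := by
      have h3 := h1 (Real.arctan x : ℝ)
      have hc := Real.cos_arctan_pos x
      have hs : Real.sin (Real.arctan x) = x * Real.cos (Real.arctan x) := by
        rw [← Real.tan_mul_cos hc.ne', Real.tan_arctan]
      rw [Real.Angle.cos_coe, Real.Angle.sin_coe, hs] at h3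
      refine nonneg_of_mul_nonneg_right (a := Real.cos (Real.arctan x) ^ 2) ?_ (by positivity)
      exact h3.trans_eq (by ring)
    have h3 := discrim_le_zero h2
    rw [discrim] at h3
    nlinarith [sq_nonneg (u i * v j - u j * v i)]
  · refine ⟨_, Nat.pos_of_ne_zero hθ, ?_⟩
    have h1 : ((addOrderOf (θ : AddCircle (2 * Real.pi)) * θ : ℝ) : Real.Angle) = 0 :=
      (Real.Angle.natCast_mul_eq_nsmul θ _).trans (addOrderOf_nsmul_eq_zero _)
    rw [← Real.Angle.cos_coe, ← Real.Angle.sin_coe, h1]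
    simp

/-- Two roots spanning a positive definite plane generate a finite group of reflections. -/
lemma exists_refl_mul_refl_pow_eq_one (hα : IsRoot cs α) (hβ : IsRoot cs β)
    (h : |form M α β| < 1) :
    ∃ n : ℕ, 0 < n ∧ (refl (form M) α * refl (form M) β) ^ n = 1 := by
  obtain ⟨h1, h2⟩ := abs_lt.1 h
  set c := form M α β with hc
  set ψ := Real.arccos c with hψ
  have hcos : Real.cos ψ = c := Real.cos_arccos h1.le h2.le
  have hsin2 : Real.sin ψ ^ 2 = 1 - c ^ 2 := by
    have := Real.sin_sq_add_cos_sq ψ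
    rw [hcos] at this
    linarith
  have hsin : Real.sin ψ ≠ 0 := by
    intro h0
    rw [h0] at hsin2
    nlinarith
  set d := (Real.sin ψ)⁻¹ • (β - c • α) with hd
  have hβd : β = Real.cos ψ • α + Real.sin ψ • d := by
    rw [hd, smul_inv_smul₀ hsin, hcos]
    module
  have hαd : form M α d = 0 := by
    simp [hd, hα.form_self, ← hc]
  have hdd : form M d d = 1 := by
    simp only [hd, map_smul, map_sub, LinearMap.smul_apply, LinearMap.sub_apply, smul_eq_mul,
      hα.form_self, hβ.form_self, form_comm β α, ← hc]
    field_simp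
    rw [hsin2]
    ring
  have hpow := refl_mul_refl_pow_apply form_comm hα.form_self hdd hαd ψ
  rw [← hβd] at hpow
  obtain ⟨n, hn, hn1, hn2⟩ : ∃ n : ℕ, 0 < n ∧ Real.cos (n * (2 * ψ)) = 1 ∧
      Real.sin (n * (2 * ψ)) = 0 := by
    refine exists_cos_eq_one (u := α) (v := d) (fun k => ?_) ?_
    · obtain ⟨t, -, ht⟩ := hα.exists_reflection
      obtain ⟨t', -, ht'⟩ := hβ.exists_reflection
      have h3 := (hα.image ((t * t') ^ k)).nonneg_or_nonpos
      rw [map_pow, map_mul, ht, ht', hpow, hα.form_self, form_comm d α, hαd] at h3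
      convert h3 using 2 <;> module
    · by_contra hcon
      push Not at hcon
      obtain ⟨j, hj⟩ := Function.ne_iff.1 hα.ne_zero
      have h3 : d = (d j / α j) • α := by
        ext i
        have := hcon i j
        simp only [Pi.zero_apply] at hj
        simp only [Pi.smul_apply, smul_eq_mul]
        field_simp
        linarith
      have h4 := hαd
      rw [h3, map_smul, hα.form_self, smul_eq_mul, mul_one] at h4
      rw [h3, h4] at hdd
      simp at hdd
  refine ⟨n, hn, LinearMap.ext fun v => ?_⟩
  rw [hpow, hn1, hn2]
  simp

lemma IsRoot.nonpos_of_sum_nonpos (hα : IsRoot cs α) (h : ∑ i, α i ≤ 0) : α ≤ 0 := by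
  by_contra hcon
  have h1 := hα.not_nonpos_iff.1 hcon
  have h2 := (Finset.sum_eq_zero_iff_of_nonneg fun i _ => h1 i).1
    (le_antisymm h (Finset.sum_nonneg fun i _ => h1 i))
  exact hα.ne_zero (funext fun i => h2 i (Finset.mem_univ i))

/-- A linear form vanishing on two given roots spanning a positive definite plane, and positive on
all but finitely many positive roots. -/
lemma exists_form_eq_zero (hα : IsRoot cs α) (hβ : IsRoot cs β) (h : |form M α β| < 1) :
    ∃ f : (B → ℝ) →ₗ[ℝ] ℝ, f α = 0 ∧ f β = 0 ∧ {γ | IsPosRoot cs γ ∧ f γ ≤ 0}.Finite := by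
  obtain ⟨n, hn, hR⟩ := exists_refl_mul_refl_pow_eq_one hα hβ h
  obtain ⟨t, -, ht⟩ := hα.exists_reflection
  obtain ⟨t', -, ht'⟩ := hβ.exists_reflection
  have hg (k : ℕ) (v : B → ℝ) :
      ((refl (form M) α * refl (form M) β) ^ k) v = rep cs ((t * t') ^ k) v := by
    rw [map_pow, map_mul, ht, ht']
  set R := refl (form M) α * refl (form M) β with hRdef
  set f : (B → ℝ) →ₗ[ℝ] ℝ :=
    ∑ k ∈ Finset.range n, (∑ i, LinearMap.proj i) ∘ₗ (R ^ k) with hf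
  have hfv (v : B → ℝ) : f v = ∑ k ∈ Finset.range n, ∑ i, (R ^ k) v i := by
    simp [hf, LinearMap.sum_apply]
  have hfR (v : B → ℝ) : f (R v) = f v := by
    have h1 := Finset.sum_range_succ (fun k => ∑ i, (R ^ k) v i) n
    rw [Finset.sum_range_succ', hR, pow_zero, add_left_inj] at h1
    rw [hfv, hfv, ← h1]
    simp only [pow_succ, Module.End.mul_apply]
  have h1 := hfR α
  have h2 := hfR β
  simp only [hRdef, Module.End.mul_apply, refl_apply, map_sub, map_smul, hα.form_self,
    hβ.form_self, form_comm β α, smul_eq_mul] at h1 h2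
  set c := form M α β with hc
  have hc2 : c ^ 2 < 1 := (sq_lt_one_iff_abs_lt_one c).2 h
  have h3 : f α = 0 := by
    have h4 : (c ^ 2 - 1) * f α = 0 := by linear_combination (1 / 2) * h1 - (c / 2) * h2
    exact (mul_eq_zero.1 h4).resolve_left (by linarith)
  have h4 : f β = 0 := by
    rw [h3] at h2
    linarith
  refine ⟨f, h3, h4, ((Finset.range n).finite_toSet.biUnion fun k _ =>
    finite_inversions (cs := cs) ((t * t') ^ k)).subset ?_⟩
  rintro γ ⟨hγ, hγ'⟩
  rw [hfv] at hγ'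
  obtain ⟨k, hk, hk'⟩ := Finset.exists_le_of_sum_le (g := fun _ => (0 : ℝ))
    (Finset.nonempty_range_iff.2 hn.ne') (hγ'.trans_eq (by simp))
  refine Set.mem_biUnion hk ⟨hγ, ?_⟩
  rw [← hg]
  refine IsRoot.nonpos_of_sum_nonpos (cs := cs) ?_ hk'
  rw [hg]
  exact hγ.1.image _

lemma finite_translate {f : (B → ℝ) →ₗ[ℝ] ℝ} (hf : {γ | IsPosRoot cs γ ∧ f γ ≤ 0}.Finite) (w : W) :
    {γ | IsPosRoot cs γ ∧ f (rep cs w γ) ≤ 0}.Finite := by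
  refine ((hf.image (rep cs w⁻¹)).union (finite_inversions (cs := cs) w)).subset ?_
  rintro γ ⟨hγ, hγ'⟩
  rcases (hγ.1.image w).nonneg_or_nonpos with h | h
  · exact Or.inl ⟨_, ⟨⟨hγ.1.image w, h⟩, hγ'⟩, rep_inv_rep cs w γ⟩
  · exact Or.inr ⟨hγ, h⟩

lemma linear_apply_eq_sum (f : (B → ℝ) →ₗ[ℝ] ℝ) (v : B → ℝ) : f v = ∑ i, v i * f (e i) := by
  conv_lhs => rw [eq_sum_e v]
  simp

/-- A linear form positive on almost all positive roots can be translated into the closed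
fundamental chamber. -/
lemma exists_nonneg_translate {f : (B → ℝ) →ₗ[ℝ] ℝ}
    (hf : {γ | IsPosRoot cs γ ∧ f γ ≤ 0}.Finite) : ∃ w, ∀ i, 0 ≤ f (rep cs w (e i)) := by
  set S : W → Set (B → ℝ) := fun w => {γ | IsPosRoot cs γ ∧ f (rep cs w γ) < 0} with hS
  have hSf (w : W) : (S w).Finite :=
    (finite_translate hf w).subset fun γ hγ => ⟨hγ.1, hγ.2.le⟩
  refine ⟨Function.argmin fun w => (S w).ncard, fun i => ?_⟩
  set w := Function.argmin fun w => (S w).ncard with hw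
  by_contra hcon
  push Not at hcon
  have h1 : (S w).ncard ≤ (S (w * cs.simple i)).ncard := Function.argmin_le (fun w => (S w).ncard) _
  refine h1.not_gt (lt_of_le_of_lt ?_
    (Set.ncard_sdiff_singleton_lt_of_mem (show e i ∈ S w from ⟨isPosRoot_e i, hcon⟩) (hSf w)))
  refine Set.ncard_le_ncard_of_injOn (refl (form M) (e i)) ?_ ?_ (hSf w).sdiff
  · rintro γ ⟨hγ, hγ'⟩
    rw [rep_mul, rep_simple] at hγ'
    have hne : γ ≠ e i := by
      rintro rfl
      rw [refl_e_self, map_neg, map_neg] at hγ'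
      linarith
    refine ⟨⟨hγ.reflect hne, hγ'⟩, fun h => ?_⟩
    have h2 := refl_refl (form_e_self (M := M) i) γ
    rw [Set.mem_singleton_iff.1 h, refl_e_self] at h2
    refine hγ.1.not_nonneg_iff.2 ?_ hγ.2
    rw [← h2]
    exact neg_nonpos.2 (e_nonneg i)
  · exact (Function.LeftInverse.injective (refl_refl (form_e_self (M := M) i))).injOn

/-- The roots supported on a set of simple roots. -/
def rootsOn (cs : CoxeterSystem M W) (I : Set B) : Set (B → ℝ) :=
  {γ | IsRoot cs γ ∧ ∀ i ∉ I, γ i = 0}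

lemma exists_rep_mem_rootsOn {f : (B → ℝ) →ₗ[ℝ] ℝ}
    (hf : {γ | IsPosRoot cs γ ∧ f γ ≤ 0}.Finite) :
    ∃ w I, (rootsOn cs I).Finite ∧ ∀ γ, IsRoot cs γ → f γ = 0 → rep cs w γ ∈ rootsOn cs I := by
  obtain ⟨w, hw⟩ := exists_nonneg_translate hf
  have hsum (v : B → ℝ) := linear_apply_eq_sum (f ∘ₗ rep cs w) v
  simp only [LinearMap.comp_apply] at hsum
  refine ⟨w⁻¹, {i | f (rep cs w (e i)) = 0}, ?_, fun γ hγ hγ' => ⟨hγ.image _, ?_⟩⟩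
  · refine ((finite_translate hf w).union ((finite_translate hf w).image fun γ => -γ)).subset ?_
    rintro γ ⟨hγ, hγ'⟩
    have h1 : f (rep cs w γ) = 0 := by
      rw [hsum]
      refine Finset.sum_eq_zero fun i _ => ?_
      by_cases hi : f (rep cs w (e i)) = 0
      · rw [hi, mul_zero]
      · rw [hγ' i hi, zero_mul]
    rcases hγ.nonneg_or_nonpos with h | h
    · exact Or.inl ⟨⟨hγ, h⟩, h1.le⟩
    · refine Or.inr ⟨-γ, ⟨⟨hγ.neg, neg_nonneg.2 h⟩, ?_⟩, neg_neg γ⟩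
      rw [map_neg, map_neg, h1, neg_zero]
  · have h1 := hsum (rep cs w⁻¹ γ)
    rw [rep_rep_inv, hγ'] at h1
    have h2 : ∀ i ∈ Finset.univ, rep cs w⁻¹ γ i * f (rep cs w (e i)) = 0 := by
      rcases (hγ.image w⁻¹).nonneg_or_nonpos with h | h
      · exact (Finset.sum_eq_zero_iff_of_nonneg fun i _ => mul_nonneg (h i) (hw i)).1 h1.symm
      · exact (Finset.sum_eq_zero_iff_of_nonpos fun i _ =>
          mul_nonpos_of_nonpos_of_nonneg (h i) (hw i)).1 h1.symm
    exact fun i hi => (mul_eq_zero.1 (h2 i (Finset.mem_univ i))).resolve_right hi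

variable (cs) in
/-- The products of roots take only finitely many values in the interval `(-1, 1)`. -/
lemma exists_finite_form_mem : ∃ F : Set ℝ, F.Finite ∧
    ∀ α β, IsRoot cs α → IsRoot cs β → |form M α β| < 1 → form M α β ∈ F := by
  refine ⟨⋃ I ∈ {I | (rootsOn cs I).Finite},
    Set.image2 (fun u v => form M u v) (rootsOn cs I) (rootsOn cs I),
    (Set.toFinite _).biUnion fun I hI => Set.Finite.image2 _ hI hI, fun α β hα hβ h => ?_⟩
  obtain ⟨f, hfα, hfβ, hf⟩ := exists_form_eq_zero hα hβ h
  obtain ⟨w, I, hI, hw⟩ := exists_rep_mem_rootsOn hf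
  exact Set.mem_biUnion (show I ∈ {I | (rootsOn cs I).Finite} from hI)
    ⟨_, hw α hα hfα, _, hw β hβ hfβ, form_rep cs w α β⟩

lemma IsChain.frozen {n : ℕ} {a : ℕ → B → ℝ} (h : IsChain cs n a) {r : B} {i k : ℕ} (hik : i ≤ k)
    (hr : form M (e r) (a i) ≤ -1) (hk : k ≤ n) : a k r = a i r ∧ form M (e r) (a k) ≤ -1 := by
  induction k, hik using Nat.le_induction with
  | base => exact ⟨rfl, hr⟩
  | succ k hik ih =>
    obtain ⟨h1, h2⟩ := ih (by omega)
    obtain ⟨s, hs, hs1, hs2⟩ := h.step k (by omega)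
    have hrs : r ≠ s := by
      rintro rfl
      linarith
    refine ⟨?_, ?_⟩
    · rw [hs, refl_e_apply_of_ne hrs, h1]
    · rw [hs, refl_apply, map_sub, map_smul, smul_eq_mul]
      nlinarith [form_e_nonpos (M := M) hrs]

lemma IsChain.ne {n : ℕ} {a : ℕ → B → ℝ} (h : IsChain cs n a) {i k : ℕ} (hik : i < k)
    (hk : k ≤ n) : a i ≠ a k := by
  have hstep (k : ℕ) (hk : k < n) : ∑ r, a k r < ∑ r, a (k + 1) r := by
    obtain ⟨s, hs, -, hs2⟩ := h.step k hk
    rw [hs, refl_apply]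
    simp only [Pi.sub_apply, Pi.smul_apply, smul_eq_mul, Finset.sum_sub_distrib, ← Finset.mul_sum]
    have : ∑ r, e s r = 1 := by simp [e]
    rw [this]
    linarith
  have : ∑ r, a i r < ∑ r, a k r := by
    induction k, hik using Nat.le_induction with
    | base => exact hstep i (by omega)
    | succ k hik ih => exact (ih (by omega)).trans (hstep k (by omega))
  intro h1
  rw [h1] at this
  exact lt_irrefl _ this

/-- Two roots in a chain are separated by their products with the simple roots, truncated below
at `-1`. -/
lemma IsChain.truncation_ne {n : ℕ} {a : ℕ → B → ℝ} (h : IsChain cs n a) {i k : ℕ} (hik : i < k)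
    (hk : k ≤ n) : ∃ r, max (-1) (form M (e r) (a i)) ≠ max (-1) (form M (e r) (a k)) := by
  by_contra hcon
  push Not at hcon
  have h1 : form M (a k - a i) (a k - a i) = 0 := by
    rw [form_eq_sum]
    refine Finset.sum_eq_zero fun r _ => ?_
    by_cases hr : form M (e r) (a i) ≤ -1
    · rw [Pi.sub_apply, (h.frozen hik.le hr hk).1, sub_self, zero_mul]
    · have h2 := hcon r
      rw [not_le] at hr
      rw [max_eq_right hr.le] at h2
      have h3 : form M (e r) (a k) = form M (e r) (a i) := by
        rcases le_total (form M (e r) (a k)) (-1) with h4 | h4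
        · rw [max_eq_left h4] at h2
          linarith
        · rw [h2, max_eq_right h4]
      rw [map_sub, h3, sub_self, mul_zero]
  have hi := h.elementary i (hik.le.trans hk)
  have hk' := h.elementary k hk
  simp only [map_sub, LinearMap.sub_apply, hi.1.1.form_self, hk'.1.1.form_self,
    form_comm (a k) (a i)] at h1
  rcases hi.1.dominates_or_dominates hk'.1 (by linarith) with h2 | h2
  · exact h.ne hik hk (hi.2 _ hk'.1 h2).symm
  · exact h.ne hik hk (hk'.2 _ hi.1 h2)

variable (cs) in
/-- Chains of elementary roots have bounded length. -/
lemma exists_chain_bound : ∃ N, ∀ n a, IsChain cs n a → n < N := by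
  obtain ⟨F, hF, hmem⟩ := exists_finite_form_mem cs
  have hQ : (Set.univ.pi fun _ : B => F ∪ {1, -1}).Finite :=
    Set.Finite.pi fun _ => hF.union (Set.toFinite _)
  refine ⟨hQ.toFinset.card, fun n a h => ?_⟩
  by_contra hn
  obtain ⟨i, hi, k, hk, hik, heq⟩ := Finset.exists_ne_map_eq_of_card_lt_of_maps_to
    (s := Finset.range (n + 1)) (t := hQ.toFinset)
    (f := fun k r => max (-1) (form M (e r) (a k))) (by rw [Finset.card_range]; omega) (by
      intro k hk
      rw [Finset.coe_range, Set.mem_Iio] at hk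
      have hel := h.elementary k (by omega)
      rw [Set.Finite.coe_toFinset, Set.mem_univ_pi]
      intro r
      change max (-1) (form M (e r) (a k)) ∈ F ∪ {1, -1}
      rcases eq_or_ne (a k) (e r) with hkr | hkr
      · rw [hkr, form_e_self]
        norm_num
      · have h1 := hel.form_lt_one hkr
        rcases le_or_gt (form M (e r) (a k)) (-1) with h2 | h2
        · rw [max_eq_left h2]
          simp
        · rw [max_eq_right h2.le]
          exact Or.inl (hmem _ _ (isRoot_e r) hel.1.1 (abs_lt.2 ⟨h2, h1⟩)))
  rw [Finset.mem_range] at hi hk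
  rcases lt_or_gt_of_ne hik with hlt | hlt
  · obtain ⟨r, hr⟩ := h.truncation_ne hlt (by omega)
    exact hr (congrFun heq r)
  · obtain ⟨r, hr⟩ := h.truncation_ne hlt (by omega)
    exact hr (congrFun heq r).symm

lemma conj_eq_simple (hα : IsPosRoot cs α) {t v : W} (ht : rep cs t = refl (form M) α) {i : B}
    (h : v⁻¹ * t * v = cs.simple i) : rep cs v⁻¹ α = e i ∨ rep cs v⁻¹ α = - e i := by
  have h1 := rep_conj_refl ht v⁻¹
  rw [inv_inv, h, rep_simple] at h1
  have h2 := hα.1.image v⁻¹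
  rcases h2.nonneg_or_nonpos with h3 | h3
  · exact Or.inl ((isPosRoot_e i).eq_of_refl_eq ⟨h2, h3⟩ h1).symm
  · right
    rw [(isPosRoot_e (cs := cs) i).eq_of_refl_eq ⟨h2.neg, neg_nonneg.2 h3⟩ (h1.trans ?_), neg_neg]
    apply LinearMap.ext
    intro u
    simp [refl_apply]

/-- The wall of a root dominated by `α` separates the fundamental chamber from the wall of `α`. -/
lemma Dominates.rep_nonpos (h : Dominates cs α β) (hα : IsPosRoot cs α) (hβ : IsPosRoot cs β)
    (hne : β ≠ α) {t v : W} (ht : rep cs t = refl (form M) α) {i : B}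
    (hv : v⁻¹ * t * v = cs.simple i) : rep cs v⁻¹ β ≤ 0 := by
  rcases conj_eq_simple hα ht hv with h1 | h1
  · rw [← (hβ.1.image v⁻¹).not_nonneg_iff]
    intro h2
    have h3 := h (cs.simple i * v⁻¹)
    rw [rep_mul, rep_mul, h1, rep_simple, refl_e_self] at h3
    have h4 := h3 (neg_nonpos.2 (e_nonneg i))
    have h5 : rep cs v⁻¹ β ≠ e i := by
      rw [← h1]
      intro h6
      exact hne (by rw [← rep_rep_inv cs v β, h6, rep_rep_inv])
    have h6 := IsPosRoot.reflect (cs := cs) ⟨hβ.1.image v⁻¹, h2⟩ h5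
    exact h6.1.not_nonpos_iff.2 h6.2 h4
  · exact h _ (h1 ▸ neg_nonpos.2 (e_nonneg i))

end ParallelWall

/-- Parallel Wall Theorem (consequence of Brink–Howlett): for a Coxeter system `(W,S)` with
`S` finite there is a constant `C''` such that any chamber at gallery distance at least `C''`
from a wall `H` is separated from `H` by a wall disjoint from `H`. -/
theorem parallel_wall_theorem
    {B W : Type*} [Group W] {M : CoxeterMatrix B} (cs : CoxeterSystem M W) [Finite B] :
    ∃ C'' : ℕ, ∀ t x : W, cs.IsReflection t →
      (∀ w : W, AdjWall cs t w → C'' ≤ cs.length (x⁻¹ * w)) →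
      ∃ t' : W, cs.IsReflection t' ∧ wall cs t ∩ wall cs t' = ∅ ∧
        ∀ w : W, AdjWall cs t w → Separates cs t' x w := by
  classical
  cases nonempty_fintype B
  open ParallelWall in
  obtain ⟨N, hN⟩ := exists_chain_bound cs
  refine ⟨N, fun t x ht hx => ?_⟩
  have ht₁ : cs.IsReflection (x⁻¹ * t * x) := by simpa using ht.conj x⁻¹
  obtain ⟨α, hα, hrα⟩ := exists_isPosRoot ht₁
  obtain ⟨β, hβ, hdom, hne⟩ : ∃ β, IsPosRoot cs β ∧ Dominates cs α β ∧ β ≠ α := by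
    by_contra hcon
    push Not at hcon
    obtain ⟨n, a, ha, rfl⟩ := IsElementary.exists_isChain (cs := cs) ⟨hα, hcon⟩
    obtain ⟨w, i, hw, hwi⟩ := ha.exists_rep_eq le_rfl
    have h1 := hN n a ha
    have h2 : x⁻¹ * t * x = w * cs.simple i * w⁻¹ := by
      refine eq_of_rep_eq (cs := cs) ?_
      rw [hrα, hwi, rep_conj_refl (rep_simple cs i)]
    have h3 := hx (x * w) ⟨i, by
      calc (x * w)⁻¹ * t * (x * w) = w⁻¹ * (x⁻¹ * t * x) * w := by group
        _ = cs.simple i := by rw [h2]; group⟩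
    rw [inv_mul_cancel_left] at h3
    omega
  obtain ⟨t', ht', hrβ⟩ := hβ.1.exists_reflection
  refine ⟨x * t' * x⁻¹, ht'.conj x, ?_, ?_⟩
  · rw [Set.eq_empty_iff_forall_notMem]
    rintro p ⟨⟨h1, -⟩, ⟨h2, -⟩⟩
    have h3 : t = x * t' * x⁻¹ := mul_right_cancel (h1.symm.trans h2)
    refine hne (hβ.eq_of_refl_eq hα ?_)
    rw [← hrα, ← hrβ, h3]
    congr 1
    group
  · rintro w ⟨i, hi⟩
    have h1 : rep cs (x⁻¹ * w)⁻¹ β ≤ 0 := by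
      refine hdom.rep_nonpos hα hβ hne hrα (i := i) ?_
      rw [← hi]
      group
    have h2 := length_lt_of_rep_inv_nonpos hβ ht' hrβ h1
    have h3 : x⁻¹ * (x * t' * x⁻¹) * w = t' * (x⁻¹ * w) := by group
    rwa [Separates, h3]
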